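/- arXiv:1810.12632 — 2 statements merged into one kernel-verified Lean document; each statement's English description precedes it below -/
import Mathlib

section
/- Let p be either 0 or a prime number and let φ be a first-order sentence in the language of rings. If φ holds in some algebraically closed field of characteristic p, then φ holds in every algebraically closed field of characteristic p. -/
open FirstOrder FirstOrder.Ring

/-- **Completeness of ACF_p**: a first-order sentence in the language of rings which holds in some
algebraically closed field of characteristic `p` (`p` zero or prime) holds in every algebraically
closed field of characteristic `p`. -/
theorem ACF_complete (p : ℕ) (hp : p = 0 ∨ p.Prime) (φ : Language.ring.Sentence)
    (k₁ : Type*) [Field k₁] [IsAlgClosed k₁] [CharP k₁ p] [CompatibleRing k₁]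
    (h : k₁ ⊨ φ) :
    ∀ (k₂ : Type*) [Field k₂] [IsAlgClosed k₂] [CharP k₂ p] [CompatibleRing k₂], k₂ ⊨ φ := by
  intro k₂ _ _ _ _
  have hT := Field.ACF_isComplete hp.symm
  exact (hT.realize_sentence_iff φ k₂).2 ((hT.realize_sentence_iff φ k₁).1 h)
end

section
/- Let g be a Lie algebra over a field k of characteristic p > 0, let ι : g → U(g) be the canonical embedding into the universal enveloping algebra, let χ₀ : g → k be a linear form, and let ψ ∈ U(g) be a semi-invariant of weight χ₀, i.e. ι(x)·ψ − ψ·ι(x) = χ₀(x)·ψ for all x ∈ g. Then ψ^p lies in the center of U(g). -/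
open UniversalEnvelopingAlgebra

theorem UniversalEnvelopingAlgebra.mkAlgHom_surjective (R L : Type*) [CommRing R] [LieRing L]
    [LieAlgebra R L] : Function.Surjective (mkAlgHom R L) :=
  RingCon.mkₐ_surjective _

/-- An element commuting with the image of `ι` is central in the enveloping algebra. -/
theorem UniversalEnvelopingAlgebra.mem_center_of_commute_ι {R L : Type*} [CommRing R] [LieRing L]
    [LieAlgebra R L] {z : UniversalEnvelopingAlgebra R L} (hz : ∀ x : L, Commute (ι R x) z) :
    z ∈ Subalgebra.center R (UniversalEnvelopingAlgebra R L) := by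
  rw [Subalgebra.mem_center_iff]
  intro u
  obtain ⟨t, rfl⟩ := mkAlgHom_surjective R L u
  change Commute _ _
  induction t using TensorAlgebra.induction with
  | algebraMap r => rw [AlgHom.commutes]; exact Algebra.commutes r z
  | ι x => exact hz x
  | mul a b ha hb => rw [map_mul]; exact ha.mul_left hb
  | add a b ha hb => rw [map_add]; exact ha.add_left hb

/-- If `a` is an eigenvector of `[b, ·]` with eigenvalue `c`, then `a ^ n` is one with eigenvalue
`n * c`. -/
theorem mul_pow_sub_pow_mul_of_mul_sub_mul_eq_smul {R A : Type*} [CommRing R] [Ring A] [Algebra R A]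
    {a b : A} {c : R} (h : b * a - a * b = c • a) (n : ℕ) :
    b * a ^ n - a ^ n * b = ((n : R) * c) • a ^ n := by
  induction n with
  | zero => simp
  | succ n ih =>
    calc b * a ^ (n + 1) - a ^ (n + 1) * b
        = (b * a ^ n - a ^ n * b) * a + a ^ n * (b * a - a * b) := by
          rw [pow_succ]; noncomm_ring
      _ = (((n + 1 : ℕ) : R) * c) • a ^ (n + 1) := by
          rw [ih, h, smul_mul_assoc, mul_smul_comm, ← pow_succ, ← add_smul]
          congr 1
          push_cast
          ring

/-- If `ψ` is a semi-invariant of weight `χ₀` in the enveloping algebra of a Lie algebra over a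
field of characteristic `p > 0`, then `ψ^p` is central. -/
theorem pow_p_of_semi_invariant_is_central
    (k : Type*) [Field k] (p : ℕ) (hp : 0 < p) [CharP k p]
    (L : Type*) [LieRing L] [LieAlgebra k L]
    (χ₀ : Module.Dual k L)
    (ψ : UniversalEnvelopingAlgebra k L)
    (hψ : ∀ x : L, ι k x * ψ - ψ * ι k x = χ₀ x • ψ) :
    ψ ^ p ∈ Subalgebra.center k (UniversalEnvelopingAlgebra k L) := by
  refine mem_center_of_commute_ι fun x => sub_eq_zero.mp ?_
  rw [mul_pow_sub_pow_mul_of_mul_sub_mul_eq_smul (hψ x), CharP.cast_eq_zero, zero_mul, zero_smul]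
end
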